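/- For every c ∈ ℝ and all k, n ∈ ℕ with k ≥ 1 such that n mod (k+1) is neither 0 nor k, the Hankel determinant with shift 1 at height k vanishes: D_{1,k,n}(c) = 0. -/

import Mathlib

/-- The Catalan-like array `a_{n,k}(s)` for natural indices. -/
def catA (s : ℕ → ℝ) : ℕ → ℕ → ℝ
  | 0, k => if k = 0 then 1 else 0
  | n + 1, k => (if k = 0 then 0 else catA s n (k - 1)) + s k * catA s n k + catA s n (k + 1)

/-- The array extended to integer indices, vanishing for `n < 0` or `k < 0`. -/
def catAZ (s : ℕ → ℝ) (n k : ℤ) : ℝ :=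
  if 0 ≤ n ∧ 0 ≤ k then catA s n.toNat k.toNat else 0

/-- Hankel determinant `D_{m,k,n}(s) = det (a_{i+j+m,k}(s))_{i,j=0}^{n-1}`. -/
def hankelD (s : ℕ → ℝ) (m : ℤ) (k n : ℕ) : ℝ :=
  Matrix.det (Matrix.of fun i j : Fin n => catAZ s ((i : ℤ) + (j : ℤ) + m) (k : ℤ))

open Polynomial

/-- The orthogonal polynomials of the array `catA` for the constant sequence `c`. -/
noncomputable def catPoly (c : ℝ) : ℕ → ℝ[X]
  | 0 => 1
  | 1 => X - C c
  | n + 2 => (X - C c) * catPoly c (n + 1) - catPoly c n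

/-- The linear functional on polynomials with moments `catA (fun _ => c) n 0`. -/
noncomputable def catFunctional (c : ℝ) : ℝ[X] →ₗ[ℝ] ℝ :=
  (Polynomial.basisMonomials ℝ).constr ℝ fun n => catA (fun _ => c) n 0

lemma catFunctional_X_pow (c : ℝ) (n : ℕ) :
    catFunctional c (X ^ n) = catA (fun _ => c) n 0 := by
  have h := (Polynomial.basisMonomials ℝ).constr_basis ℝ (fun n => catA (fun _ => c) n 0) n
  rw [coe_basisMonomials] at h
  rw [X_pow_eq_monomial]
  exact h

lemma catFunctional_X_pow_mul_catPoly (c : ℝ) (k n : ℕ) :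
    catFunctional c (X ^ n * catPoly c k) = catA (fun _ => c) n k := by
  induction k using Nat.twoStepInduction generalizing n with
  | zero => simp [catPoly, catFunctional_X_pow]
  | one =>
    have h : X ^ n * catPoly c 1 = X ^ (n + 1) - c • X ^ n := by
      rw [catPoly, smul_eq_C_mul]; ring
    rw [h, map_sub, map_smul, catFunctional_X_pow, catFunctional_X_pow, catA]
    simp
  | more k ih₀ ih₁ =>
    have h : X ^ n * catPoly c (k + 2) = X ^ (n + 1) * catPoly c (k + 1)
        - c • (X ^ n * catPoly c (k + 1)) - X ^ n * catPoly c k := by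
      rw [catPoly, smul_eq_C_mul]; ring
    rw [h, map_sub, map_sub, map_smul, ih₀, ih₁, ih₁, catA]
    simp only [Nat.add_eq_zero_iff, one_ne_zero, and_false, if_false, Nat.add_sub_cancel,
      smul_eq_mul]
    ring

lemma catA_eq_zero_of_lt (s : ℕ → ℝ) {n k : ℕ} (h : n < k) : catA s n k = 0 := by
  induction n generalizing k with
  | zero => simp [catA, h.ne']
  | succ n ih =>
    rw [catA, if_neg (by omega), ih (by omega), ih (by omega), ih (by omega)]
    simp

lemma catPoly_monic_natDegree (c : ℝ) (n : ℕ) :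
    (catPoly c n).Monic ∧ (catPoly c n).natDegree = n := by
  induction n using Nat.twoStepInduction with
  | zero => simp [catPoly]
  | one => exact ⟨monic_X_sub_C c, natDegree_X_sub_C c⟩
  | more n ih₀ ih₁ =>
    have hm : ((X - C c) * catPoly c (n + 1)).Monic := (monic_X_sub_C c).mul ih₁.1
    have hd : ((X - C c) * catPoly c (n + 1)).natDegree = n + 2 := by
      rw [(monic_X_sub_C c).natDegree_mul ih₁.1, natDegree_X_sub_C, ih₁.2]; ring
    have hlt : (catPoly c n).natDegree < ((X - C c) * catPoly c (n + 1)).natDegree := by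
      rw [hd, ih₀.2]; omega
    rw [catPoly]
    exact ⟨hm.sub_of_left (degree_lt_degree hlt), by
      rw [natDegree_sub_eq_left_of_natDegree_lt hlt, hd]⟩

lemma catPoly_add (c : ℝ) (a b : ℕ) :
    catPoly c (a + b + 2)
      = catPoly c (a + 1) * catPoly c (b + 1) - catPoly c a * catPoly c b := by
  induction b using Nat.twoStepInduction with
  | zero => simp only [catPoly]; ring
  | one =>
    simp only [catPoly]; ring
  | more b ih₀ ih₁ =>
    have h₁ : catPoly c (a + (b + 2) + 2)
        = (X - C c) * catPoly c (a + (b + 1) + 2) - catPoly c (a + b + 2) := rfl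
    have h₂ : catPoly c (b + 2 + 1)
        = (X - C c) * catPoly c (b + 1 + 1) - catPoly c (b + 1) := rfl
    have h₃ : catPoly c (b + 2) = (X - C c) * catPoly c (b + 1) - catPoly c b := rfl
    rw [h₁, ih₀, ih₁, h₂, show b + 1 + 1 = b + 2 from rfl, h₃]; ring

lemma catPoly_dvd (c : ℝ) {k : ℕ} (hk : 1 ≤ k) (m : ℕ) :
    catPoly c k ∣ catPoly c (m * (k + 1) + k) := by
  induction m with
  | zero => simp
  | succ m ih =>
    obtain ⟨a, ha⟩ : ∃ a, m * (k + 1) + k = a + 1 := ⟨m * (k + 1) + k - 1, by omega⟩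
    rw [ha] at ih
    have h : (m + 1) * (k + 1) + k = a + k + 2 := by rw [Nat.succ_mul]; omega
    rw [h, catPoly_add]
    exact dvd_sub (ih.mul_right _) (Dvd.intro_left _ rfl)

/-- Identity (8), vanishing cases: for `k ≥ 1`, if `n mod (k+1)` is neither `0` nor `k`
then `D_{1,k,n}(c) = 0`. -/
theorem hankel_one_shift_const_vanishes (c : ℝ) (k n : ℕ) (hk : 1 ≤ k)
    (h0 : n % (k + 1) ≠ 0) (hkk : n % (k + 1) ≠ k) :
    hankelD (fun _ => c) 1 k n = 0 := by
  have hlt : n % (k + 1) < k + 1 := Nat.mod_lt _ k.succ_pos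
  have hdiv : n / (k + 1) * (k + 1) + n % (k + 1) = n := Nat.div_add_mod' n (k + 1)
  obtain ⟨q, hq⟩ := catPoly_dvd c hk (n / (k + 1))
  set d := n / (k + 1) * (k + 1)
  have hqm : q.Monic :=
    (catPoly_monic_natDegree c k).1.of_mul_monic_left (hq ▸ (catPoly_monic_natDegree c _).1)
  have hqd : q.natDegree < n := by
    have h := congrArg natDegree hq
    rw [(catPoly_monic_natDegree c k).1.natDegree_mul hqm, (catPoly_monic_natDegree c _).2,
      (catPoly_monic_natDegree c _).2] at h
    omega
  refine Matrix.exists_mulVec_eq_zero_iff.mp ⟨fun j : Fin n => q.coeff j, fun h => ?_, ?_⟩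
  · have := congrFun h ⟨q.natDegree, hqd⟩
    simp [hqm.leadingCoeff] at this
  · ext i
    have hexp : X ^ ((i : ℕ) + 1) * catPoly c (d + k)
        = ∑ j : Fin n, q.coeff j • (X ^ ((i : ℕ) + j + 1) * catPoly c k) := by
      rw [hq]
      conv_lhs => rw [q.as_sum_range_C_mul_X_pow' hqd]
      rw [← Fin.sum_univ_eq_sum_range (fun j => C (q.coeff j) * X ^ j), Finset.mul_sum,
        Finset.mul_sum]
      refine Finset.sum_congr rfl fun j _ => ?_
      rw [smul_eq_C_mul]; ring
    have h := congrArg (catFunctional c) hexp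
    rw [catFunctional_X_pow_mul_catPoly, catA_eq_zero_of_lt _ (by omega), map_sum] at h
    rw [Pi.zero_apply, h, Matrix.mulVec, dotProduct]
    refine Finset.sum_congr rfl fun j _ => ?_
    rw [map_smul, catFunctional_X_pow_mul_catPoly, smul_eq_mul, mul_comm, Matrix.of_apply,
      catAZ, if_pos (by omega)]
    congr 2
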